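/- Let z ∈ K with z_x ≠ 0 and z_y ≠ 0, set q = −z_x/z_y, and define I30(z) = −z_xxy/z_x + z_xx·z_xy/z_x² + z_xy²/(2·z_x·z_y). Then I3 = I30(z) satisfies equation (E3): ∂x(I3) + q·∂y(I3) + (q_y − q_x/q)·I3 = (q_x/q)·∂y(q_x/q) − ∂x(∂y(q_x/q)). (A class of particular solutions of the invariant PDE on I3 constructed from an arbitrary nonconstant element z, not required to be a ratio of solutions of L.) -/

import Mathlib

/-- A class of particular solutions of the invariant PDE (E3) on `I3`,
constructed from an arbitrary nonconstant element `z` (not required to be a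
ratio of solutions of `L`): with `q = −z_x/z_y`,
`I30(z) = −z_xxy/z_x + z_xx z_xy/z_x² + z_xy²/(2 z_x z_y)` satisfies (E3). -/
theorem particular_solution_I30 {K : Type*} [Field K] [CharZero K]
    (X Y : Derivation ℚ K K) (hcomm : ∀ f : K, X (Y f) = Y (X f))
    (z : K) (hzx : X z ≠ 0) (hzy : Y z ≠ 0)
    (q I3 : K)
    (hq : q = -(X z) / Y z)
    (hI3 : I3 = -(X (X (Y z))) / X z + X (X z) * X (Y z) / (X z) ^ 2
        + (X (Y z)) ^ 2 / (2 * X z * Y z)) :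
    X I3 + q * Y I3 + (Y q - X q / q) * I3
      = (X q / q) * Y (X q / q) - X (Y (X q / q)) := by
  have hr : X q / q = X (X z) / X z - X (Y z) / Y z := by
    rw [hq, Derivation.leibniz_div]
    simp only [map_neg, smul_eq_mul]
    field_simp
    ring
  have h2 : Y 2 = 0 := by exact_mod_cast Y.map_natCast 2
  have h2' : X 2 = 0 := by exact_mod_cast X.map_natCast 2
  rw [hr, hI3, hq]
  simp only [map_add, map_sub, map_neg, Derivation.leibniz_div, Derivation.leibniz_inv,
    Derivation.leibniz, Derivation.leibniz_pow, smul_eq_mul, nsmul_eq_mul, h2, h2', ← hcomm,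
    Nat.cast_ofNat, pow_one, Nat.add_one_sub_one]
  field_simp
  ring
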